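/- Let A be a unital ℂ-algebra, p = (p_{rs}) ∈ M_n(A) an idempotent, u := e_{00} ∈ 𝒮, and regard p⊗u := (p_{rs}⊗u) ∈ M_n(A⊗𝒯), acting on column vectors in ((Σ²A)_fin)ⁿ. Then: (i) (p⊗u)·((Σ²A)_fin)ⁿ = (p⊗u)·(A⊗𝒮)ⁿ; (ii) the assignment p(a₁,…,a_n) ⊗ (uT) ↦ (p⊗u)(a₁⊗T, …, a_n⊗T), for a₁,…,a_n ∈ A and T ∈ 𝒮, extends to a well-defined ℂ-linear bijection from (pAⁿ) ⊗_ℂ (u𝒮) onto (p⊗u)(A⊗𝒮)ⁿ, whose inverse sends (p⊗u)(a₁⊗T₁, …, a_n⊗T_n) to Σ_{i=1}^{n} p(0,…,a_i,…,0) ⊗ uT_i (with a_i in the i-th coordinate). (This is the paper's module isomorphism (p⊗u)(Σ²A)ⁿ ≅ pAⁿ ⊗ u𝒮 underlying the comparison of connections on 𝓔 and on its suspension 𝓔̃.) -/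

import Mathlib

open scoped TensorProduct

noncomputable section

/-- `V` is the ℂ-vector space of finitely supported sequences `ℕ → ℂ`. -/
def V : Type := ℕ →₀ ℂ

instance : AddCommGroup V := inferInstanceAs (AddCommGroup (ℕ →₀ ℂ))
instance : Module ℂ V := inferInstanceAs (Module ℂ (ℕ →₀ ℂ))

/-- The matrix unit `e_{ij}`, determined by `e_{ij} e_k = δ_{jk} e_i`. -/
def matUnit (i j : ℕ) : Module.End ℂ V := (Finsupp.lapply j).smulRight (Finsupp.single i 1)

/-- `𝒮`, the linear span of the matrix units (the finitely supported matrices). -/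
def finS : Submodule ℂ (Module.End ℂ V) :=
  Submodule.span ℂ (Set.range fun p : ℕ × ℕ => matUnit p.1 p.2)

/-- The left shift `l` : `l e_0 = 0`, `l e_{k+1} = e_k`. -/
def lshift : Module.End ℂ V :=
  Finsupp.lsum ℂ fun k => if k = 0 then 0 else Finsupp.lsingle (k - 1)

/-- The right shift `l*` : `l* e_k = e_{k+1}`. -/
def rshift : Module.End ℂ V := Finsupp.lsum ℂ fun k => Finsupp.lsingle (k + 1)

variable (A : Type*) [Ring A] [Algebra ℂ A]

/-- `A ⊗ 𝒮`: the linear span of the simple tensors `a ⊗ T` with `T ∈ 𝒮`. -/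
def AtS : Submodule ℂ (A ⊗[ℂ] Module.End ℂ V) :=
  Submodule.span ℂ
    {x : A ⊗[ℂ] Module.End ℂ V |
      ∃ (a : A) (T : Module.End ℂ V), T ∈ finS ∧ x = a ⊗ₜ[ℂ] T}

/-- `(Σ²A)_fin`: the subalgebra of `A ⊗ 𝒯 ⊆ A ⊗ End(V)` generated by the elements
`a ⊗ T` (`T ∈ 𝒮`) together with `1 ⊗ l` and `1 ⊗ l*`. -/
def QDSfin : Subalgebra ℂ (A ⊗[ℂ] Module.End ℂ V) :=
  Algebra.adjoin ℂ
    ({x : A ⊗[ℂ] Module.End ℂ V |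
        ∃ (a : A) (T : Module.End ℂ V), T ∈ finS ∧ x = a ⊗ₜ[ℂ] T}
      ∪ {(1 : A) ⊗ₜ[ℂ] lshift, (1 : A) ⊗ₜ[ℂ] rshift})

variable {A}

/-- Multiplication by a (possibly noncommutative) square matrix on column vectors,
as a ℂ-linear map. -/
def mulVecC {A' : Type*} [Ring A'] [Algebra ℂ A'] {n : ℕ}
    (p : Matrix (Fin n) (Fin n) A') : (Fin n → A') →ₗ[ℂ] (Fin n → A') where
  toFun v := p.mulVec v
  map_add' v w := Matrix.mulVec_add p v w
  map_smul' c v := Matrix.mulVec_smul p c v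

/-- `pAⁿ = {p·v : v ∈ Aⁿ}` as a ℂ-subspace of `Aⁿ`. -/
def pAn {n : ℕ} (p : Matrix (Fin n) (Fin n) A) : Submodule ℂ (Fin n → A) :=
  LinearMap.range (mulVecC p)

/-- `u𝒮 = {uT : T ∈ 𝒮}` where `u = e₀₀`. -/
def uS : Submodule ℂ (Module.End ℂ V) :=
  Submodule.map (LinearMap.mulLeft ℂ (matUnit 0 0)) finS

/-- `(p⊗u)(A⊗𝒮)ⁿ` as a ℂ-subspace of `((Σ²A)_fin ⊆ A ⊗ End V)ⁿ`. -/
def puAS {n : ℕ} (p : Matrix (Fin n) (Fin n) A) :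
    Submodule ℂ (Fin n → A ⊗[ℂ] Module.End ℂ V) :=
  Submodule.map (mulVecC (Matrix.of fun r s => p r s ⊗ₜ[ℂ] matUnit 0 0))
    (Submodule.pi Set.univ fun _ => AtS A)

/-- The standard basis vector `e_k` of `V`. -/
def stdV (k : ℕ) : V := Finsupp.single k (1 : ℂ)

lemma lshift_stdV (k : ℕ) : lshift (stdV k) = if k = 0 then 0 else stdV (k - 1) := by
  refine (Finsupp.sum_single_index (h := fun k c => (if k = 0 then
    (0 : ℂ →ₗ[ℂ] ℕ →₀ ℂ) else Finsupp.lsingle (k - 1)) c) (by simp)).trans ?_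
  split_ifs <;> rfl

lemma rshift_stdV (k : ℕ) : rshift (stdV k) = stdV (k + 1) :=
  Finsupp.sum_single_index (h := fun k c => (Finsupp.single (k + 1) c : ℕ →₀ ℂ)) (by simp)

lemma matUnit_stdV (i j k : ℕ) : matUnit i j (stdV k) = if k = j then stdV i else 0 := by
  have h : matUnit i j (stdV k) = (Finsupp.single k (1 : ℂ) : ℕ →₀ ℂ) j • stdV i := rfl
  rw [h, Finsupp.single_apply]
  split_ifs
  · exact one_smul ℂ _
  · exact zero_smul ℂ _

/-- Endomorphisms of `V` agreeing on the standard basis are equal. -/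
lemma end_V_ext {f g : Module.End ℂ V} (h : ∀ k, f (stdV k) = g (stdV k)) : f = g :=
  Finsupp.lhom_ext' (M := ℂ) (N := V) (φ := f) (ψ := g)
    fun k => LinearMap.ext_ring (h k)

lemma matUnit_mul_matUnit (i j k l : ℕ) :
    matUnit i j * matUnit k l = if j = k then matUnit i l else 0 := by
  refine end_V_ext fun m => ?_
  rw [Module.End.mul_apply, matUnit_stdV]
  by_cases hm : m = l
  · rw [if_pos hm, matUnit_stdV]
    by_cases hj : j = k
    · rw [if_pos hj, if_pos hj.symm, matUnit_stdV, if_pos hm]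
    · rw [if_neg hj, if_neg (Ne.symm hj)]; rfl
  · rw [if_neg hm]
    refine (map_zero (matUnit i j)).trans ?_
    by_cases hj : j = k
    · rw [if_pos hj, matUnit_stdV, if_neg hm]
    · rw [if_neg hj]; rfl

lemma matUnit_mul_lshift (i j : ℕ) : matUnit i j * lshift = matUnit i (j + 1) := by
  refine end_V_ext fun m => ?_
  rw [Module.End.mul_apply, lshift_stdV, matUnit_stdV]
  obtain _ | m := m
  · rw [if_pos rfl, if_neg (by omega)]
    exact map_zero (matUnit i j)
  · rw [if_neg (by omega), Nat.add_sub_cancel, matUnit_stdV]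
    simp only [Nat.add_right_cancel_iff]

lemma matUnit_mul_rshift (i j : ℕ) :
    matUnit i j * rshift = if j = 0 then 0 else matUnit i (j - 1) := by
  refine end_V_ext fun m => ?_
  rw [Module.End.mul_apply, rshift_stdV, matUnit_stdV]
  obtain _ | j := j
  · rw [if_pos rfl, if_neg (by omega)]; rfl
  · rw [if_neg (show ¬ (j + 1 = 0) by omega), Nat.add_sub_cancel, matUnit_stdV]
    simp only [Nat.add_right_cancel_iff]

lemma matUnit_mem_finS (i j : ℕ) : matUnit i j ∈ finS :=
  Submodule.subset_span ⟨(i, j), rfl⟩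

lemma mul_mem_finS_of_matUnit {X : Module.End ℂ V} (hX : ∀ i j, matUnit i j * X ∈ finS)
    {T : Module.End ℂ V} (hT : T ∈ finS) : T * X ∈ finS := by
  have h : finS ≤ finS.comap (LinearMap.mulRight ℂ X) :=
    Submodule.span_le.mpr (by rintro _ ⟨⟨i, j⟩, rfl⟩; exact hX i j)
  exact h hT

lemma mul_lshift_mem_finS {T : Module.End ℂ V} (hT : T ∈ finS) : T * lshift ∈ finS :=
  mul_mem_finS_of_matUnit
    (fun i j => by rw [matUnit_mul_lshift]; exact matUnit_mem_finS _ _) hT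

lemma mul_rshift_mem_finS {T : Module.End ℂ V} (hT : T ∈ finS) : T * rshift ∈ finS := by
  refine mul_mem_finS_of_matUnit (fun i j => ?_) hT
  rw [matUnit_mul_rshift]
  split_ifs
  · exact zero_mem _
  · exact matUnit_mem_finS _ _

lemma matUnit_mul_mem_finS (i j : ℕ) {T : Module.End ℂ V} (hT : T ∈ finS) :
    matUnit i j * T ∈ finS := by
  have h : finS ≤ finS.comap (LinearMap.mulLeft ℂ (matUnit i j)) := by
    refine Submodule.span_le.mpr ?_
    rintro _ ⟨⟨k, l⟩, rfl⟩
    change matUnit i j * matUnit k l ∈ finS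
    rw [matUnit_mul_matUnit]
    split_ifs
    · exact matUnit_mem_finS _ _
    · exact zero_mem _
  exact h hT

lemma mul_mem_finS {T T' : Module.End ℂ V} (hT : T ∈ finS) (hT' : T' ∈ finS) :
    T * T' ∈ finS :=
  mul_mem_finS_of_matUnit (fun i j => matUnit_mul_mem_finS i j hT') hT

lemma tmul_mem_AtS (a : A) {T : Module.End ℂ V} (hT : T ∈ finS) : a ⊗ₜ[ℂ] T ∈ AtS A :=
  Submodule.subset_span ⟨a, T, hT, rfl⟩

lemma AtS_le_QDSfin : AtS A ≤ Subalgebra.toSubmodule (QDSfin A) :=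
  Submodule.span_le.mpr fun _ hx => Algebra.subset_adjoin (Or.inl hx)

/-- `A ⊗ 𝒮` is stable under right multiplication by `b ⊗ X` whenever `𝒮 X ⊆ 𝒮`. -/
lemma mul_tmul_mem_AtS (b : A) {X : Module.End ℂ V} (hX : ∀ T ∈ finS, T * X ∈ finS)
    {y : A ⊗[ℂ] Module.End ℂ V} (hy : y ∈ AtS A) : y * b ⊗ₜ[ℂ] X ∈ AtS A := by
  have h : AtS A ≤ (AtS A).comap (LinearMap.mulRight ℂ (b ⊗ₜ[ℂ] X)) := by
    refine Submodule.span_le.mpr ?_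
    rintro _ ⟨a, T, hT, rfl⟩
    change a ⊗ₜ[ℂ] T * b ⊗ₜ[ℂ] X ∈ AtS A
    rw [Algebra.TensorProduct.tmul_mul_tmul]
    exact tmul_mem_AtS _ (hX T hT)
  exact h hy

/-- `A ⊗ 𝒮` is a right ideal with respect to `(Σ²A)_fin`. -/
lemma mul_mem_AtS {x y : A ⊗[ℂ] Module.End ℂ V} (hy : y ∈ AtS A) (hx : x ∈ QDSfin A) :
    y * x ∈ AtS A := by
  induction hx using Algebra.adjoin_induction generalizing y with
  | mem x hx =>
    rcases hx with ⟨a, T, hT, rfl⟩ | rfl | rfl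
    · exact mul_tmul_mem_AtS a (fun T' hT' => mul_mem_finS hT' hT) hy
    · exact mul_tmul_mem_AtS 1 (fun T' hT' => mul_lshift_mem_finS hT') hy
    · exact mul_tmul_mem_AtS 1 (fun T' hT' => mul_rshift_mem_finS hT') hy
  | algebraMap r =>
    rw [← Algebra.commutes, ← Algebra.smul_def]
    exact Submodule.smul_mem _ r hy
  | add x z _ _ hx hz => rw [mul_add]; exact add_mem (hx hy) (hz hy)
  | mul x z _ _ hx hz => rw [← mul_assoc]; exact hz (hx hy)

/-- The comparison map `pAⁿ ⊗ u𝒮 → (A ⊗ End V)ⁿ`, `v ⊗ S ↦ (v₁ ⊗ S, …, vₙ ⊗ S)`. -/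
def suspMap {n : ℕ} (p : Matrix (Fin n) (Fin n) A) :
    pAn p ⊗[ℂ] uS →ₗ[ℂ] (Fin n → A ⊗[ℂ] Module.End ℂ V) :=
  (TensorProduct.piLeft ℂ (Module.End ℂ V) fun _ : Fin n => A).toLinearMap ∘ₗ
    TensorProduct.map (pAn p).subtype uS.subtype

lemma suspMap_tmul {n : ℕ} (p : Matrix (Fin n) (Fin n) A) (v : pAn p) (S : uS) (i : Fin n) :
    suspMap p (v ⊗ₜ[ℂ] S) i = (v : Fin n → A) i ⊗ₜ[ℂ] (S : Module.End ℂ V) := rfl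

lemma suspMap_injective {n : ℕ} (p : Matrix (Fin n) (Fin n) A) :
    Function.Injective (suspMap p) :=
  (LinearEquiv.injective (TensorProduct.piLeft ℂ (Module.End ℂ V) fun _ : Fin n => A)).comp
    (TensorProduct.map_injective_of_flat_flat _ _ (Submodule.injective_subtype _)
      (Submodule.injective_subtype _))

lemma suspMap_mulVec_tmul {n : ℕ} (p : Matrix (Fin n) (Fin n) A) (a : Fin n → A)
    (T : Module.End ℂ V) (h₁ : p.mulVec a ∈ pAn p) (h₂ : matUnit 0 0 * T ∈ uS) :
    suspMap p (⟨p.mulVec a, h₁⟩ ⊗ₜ[ℂ] ⟨matUnit 0 0 * T, h₂⟩)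
      = (Matrix.of fun r s => p r s ⊗ₜ[ℂ] matUnit 0 0).mulVec fun i => a i ⊗ₜ[ℂ] T := by
  ext1 i
  simp only [suspMap_tmul, Matrix.mulVec, dotProduct, TensorProduct.sum_tmul, Matrix.of_apply,
    Algebra.TensorProduct.tmul_mul_tmul]

lemma single_tmul {n : ℕ} (i : Fin n) (a : A) (T : Module.End ℂ V) :
    (fun j => (Pi.single i a : Fin n → A) j ⊗ₜ[ℂ] T)
      = (Pi.single i (a ⊗ₜ[ℂ] T) : Fin n → A ⊗[ℂ] Module.End ℂ V) := by
  ext1 j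
  rcases eq_or_ne j i with rfl | h
  · simp
  · simp [h]

lemma suspMap_range {n : ℕ} (p : Matrix (Fin n) (Fin n) A) :
    LinearMap.range (suspMap p) = puAS p := by
  apply le_antisymm
  · rintro _ ⟨x, rfl⟩
    induction x using TensorProduct.induction_on with
    | zero => rw [map_zero]; exact zero_mem _
    | add x y hx hy => rw [map_add]; exact add_mem hx hy
    | tmul v S =>
      obtain ⟨_, a, rfl⟩ := v
      obtain ⟨_, T, hT, rfl⟩ := S
      exact ⟨fun i => a i ⊗ₜ[ℂ] T, Submodule.mem_pi.mpr fun i _ => tmul_mem_AtS _ hT,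
        (suspMap_mulVec_tmul p a T _ _).symm⟩
  · rintro _ ⟨v, hv, rfl⟩
    rw [← Finset.univ_sum_single v, map_sum]
    refine sum_mem fun i _ => ?_
    have h : AtS A ≤ (LinearMap.range (suspMap p)).comap
        (mulVecC (Matrix.of fun r s => p r s ⊗ₜ[ℂ] matUnit 0 0) ∘ₗ
          LinearMap.single ℂ (fun _ : Fin n => A ⊗[ℂ] Module.End ℂ V) i) := by
      refine Submodule.span_le.mpr ?_
      rintro _ ⟨a, T, hT, rfl⟩
      refine ⟨⟨p.mulVec (Pi.single i a), ⟨_, rfl⟩⟩ ⊗ₜ[ℂ] ⟨matUnit 0 0 * T, ⟨T, hT, rfl⟩⟩, ?_⟩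
      refine (suspMap_mulVec_tmul p _ T _ _).trans ?_
      rw [single_tmul]
      rfl
    exact h (Submodule.mem_pi.mp hv i (Set.mem_univ i))

/-- The isomorphism `pAⁿ ⊗ u𝒮 ≅ (p⊗u)(A⊗𝒮)ⁿ`. -/
def suspEquiv {n : ℕ} (p : Matrix (Fin n) (Fin n) A) : (pAn p ⊗[ℂ] uS) ≃ₗ[ℂ] puAS p :=
  (LinearEquiv.ofInjective (suspMap p) (suspMap_injective p)).trans
    (LinearEquiv.ofEq _ _ (suspMap_range p))

lemma coe_suspEquiv {n : ℕ} (p : Matrix (Fin n) (Fin n) A) (x : pAn p ⊗[ℂ] uS) :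
    (suspEquiv p x : Fin n → A ⊗[ℂ] Module.End ℂ V) = suspMap p x := rfl

/-- Left multiplication by `1 ⊗ u` does not change `(p⊗u)v`. -/
lemma mulVec_one_tmul_mul {n : ℕ} (p : Matrix (Fin n) (Fin n) A)
    (v : Fin n → A ⊗[ℂ] Module.End ℂ V) :
    (Matrix.of fun r s => p r s ⊗ₜ[ℂ] matUnit 0 0).mulVec
        (fun i => (1 : A) ⊗ₜ[ℂ] matUnit 0 0 * v i)
      = (Matrix.of fun r s => p r s ⊗ₜ[ℂ] matUnit 0 0).mulVec v := by
  ext1 i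
  simp only [Matrix.mulVec, dotProduct, Matrix.of_apply, ← mul_assoc,
    Algebra.TensorProduct.tmul_mul_tmul, mul_one, matUnit_mul_matUnit, if_true]

/-- For an idempotent `p ∈ Mₙ(A)` and `u = e₀₀`:
(i) `(p⊗u)((Σ²A)_fin)ⁿ = (p⊗u)(A⊗𝒮)ⁿ`;
(ii) there is a ℂ-linear bijection `(pAⁿ) ⊗ (u𝒮) ≅ (p⊗u)(A⊗𝒮)ⁿ` sending
`p(a₁,…,aₙ) ⊗ uT` to `(p⊗u)(a₁⊗T, …, aₙ⊗T)`, whose inverse sends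
`(p⊗u)(a₁⊗T₁, …, aₙ⊗Tₙ)` to `Σᵢ p(0,…,aᵢ,…,0) ⊗ uTᵢ`. -/
theorem stmt_16 {n : ℕ} (p : Matrix (Fin n) (Fin n) A) (hp : p * p = p) :
    ({x : Fin n → A ⊗[ℂ] Module.End ℂ V |
        ∃ v : Fin n → A ⊗[ℂ] Module.End ℂ V,
          (∀ i, v i ∈ QDSfin A) ∧
          x = (Matrix.of fun r s => p r s ⊗ₜ[ℂ] matUnit 0 0).mulVec v}
      = {x : Fin n → A ⊗[ℂ] Module.End ℂ V |
        ∃ v : Fin n → A ⊗[ℂ] Module.End ℂ V,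
          (∀ i, v i ∈ AtS A) ∧
          x = (Matrix.of fun r s => p r s ⊗ₜ[ℂ] matUnit 0 0).mulVec v}) ∧
    (∃ e : (pAn p ⊗[ℂ] uS) ≃ₗ[ℂ] puAS p,
      (∀ (a : Fin n → A) (T : Module.End ℂ V) (hT : T ∈ finS),
        e (⟨p.mulVec a, LinearMap.mem_range.mpr ⟨a, rfl⟩⟩ ⊗ₜ[ℂ]
            ⟨matUnit 0 0 * T, Submodule.mem_map.mpr ⟨T, hT, rfl⟩⟩)
          = ⟨(Matrix.of fun r s => p r s ⊗ₜ[ℂ] matUnit 0 0).mulVec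
                (fun i => a i ⊗ₜ[ℂ] T),
              Submodule.mem_map.mpr ⟨fun i => a i ⊗ₜ[ℂ] T,
                Submodule.mem_pi.mpr fun i _ => Submodule.subset_span ⟨a i, T, hT, rfl⟩,
                rfl⟩⟩) ∧
      (∀ (a : Fin n → A) (T : Fin n → Module.End ℂ V) (hT : ∀ i, T i ∈ finS),
        e.symm
            ⟨(Matrix.of fun r s => p r s ⊗ₜ[ℂ] matUnit 0 0).mulVec
                (fun i => a i ⊗ₜ[ℂ] T i),
              Submodule.mem_map.mpr ⟨fun i => a i ⊗ₜ[ℂ] T i,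
                Submodule.mem_pi.mpr fun i _ =>
                  Submodule.subset_span ⟨a i, T i, hT i, rfl⟩,
                rfl⟩⟩
          = ∑ i, (⟨p.mulVec (Pi.single i (a i)),
                LinearMap.mem_range.mpr ⟨Pi.single i (a i), rfl⟩⟩ ⊗ₜ[ℂ]
              ⟨matUnit 0 0 * T i, Submodule.mem_map.mpr ⟨T i, hT i, rfl⟩⟩))) := by
  refine ⟨Set.ext fun x => ⟨?_, ?_⟩, suspEquiv p, fun a T hT => ?_, fun a T hT => ?_⟩
  · rintro ⟨v, hv, rfl⟩
    exact ⟨fun i => (1 : A) ⊗ₜ[ℂ] matUnit 0 0 * v i,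
      fun i => mul_mem_AtS (tmul_mem_AtS 1 (matUnit_mem_finS 0 0)) (hv i),
      (mulVec_one_tmul_mul p v).symm⟩
  · rintro ⟨v, hv, rfl⟩
    exact ⟨v, fun i => AtS_le_QDSfin (hv i), rfl⟩
  · exact Subtype.ext (suspMap_mulVec_tmul p a T _ _)
  · rw [LinearEquiv.symm_apply_eq]
    refine Subtype.ext ?_
    rw [coe_suspEquiv, map_sum]
    have h := map_sum (mulVecC (Matrix.of fun r s => p r s ⊗ₜ[ℂ] matUnit 0 0))
      (fun i => (Pi.single i (a i ⊗ₜ[ℂ] T i) : Fin n → A ⊗[ℂ] Module.End ℂ V)) Finset.univ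
    rw [Finset.univ_sum_single fun i => a i ⊗ₜ[ℂ] T i] at h
    refine h.trans (Finset.sum_congr rfl fun i _ => ?_)
    refine Eq.trans ?_ (suspMap_mulVec_tmul p _ (T i) _ _).symm
    rw [single_tmul]
    rfl
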